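/- Let s, t be nonzero real numbers with s² + 4t > 0 and |φ'_{s,t}| < |φ_{s,t}|. Then the series Σ_{n=1}^{∞} t^n/{2n}_{s,t} converges and equals √(s²+4t)·(L(φ'_{s,t}²/t) − L(φ'_{s,t}⁴/t²)), where L(x) = Σ_{n=1}^{∞} x^n/(1−x^n) is the Lambert series; that is, Σ_{n=1}^{∞} t^n/{2n}_{s,t} = √(s²+4t)·(Σ_{n=1}^{∞} (φ'_{s,t}²/t)^n/(1−(φ'_{s,t}²/t)^n) − Σ_{n=1}^{∞} (φ'_{s,t}⁴/t²)^n/(1−(φ'_{s,t}⁴/t²)^n)). -/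

import Mathlib

/-- Generalized Fibonacci polynomials/numbers: `{0} = 0`, `{1} = 1`,
`{n+2} = s·{n+1} + t·{n}`. -/
noncomputable def gfib (s t : ℝ) : ℕ → ℝ
  | 0 => 0
  | 1 => 1
  | n + 2 => s * gfib s t (n + 1) + t * gfib s t n

/-- Generalized fibotorial `{n}! = {1}·{2}⋯{n}`, with `{0}! = 1`. -/
noncomputable def gfibFact (s t : ℝ) (n : ℕ) : ℝ :=
  ∏ k ∈ Finset.range n, gfib s t (k + 1)

/-- Generalized fibonomial coefficient `{n choose k} = {n}!/({k}!·{n−k}!)`. -/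
noncomputable def gfibBinom (s t : ℝ) (n k : ℕ) : ℝ :=
  gfibFact s t n / (gfibFact s t k * gfibFact s t (n - k))

/-- `φ_{s,t} = (s + √(s²+4t))/2`. -/
noncomputable def phiST (s t : ℝ) : ℝ := (s + Real.sqrt (s ^ 2 + 4 * t)) / 2

/-- `φ'_{s,t} = (s − √(s²+4t))/2`. -/
noncomputable def phiST' (s t : ℝ) : ℝ := (s - Real.sqrt (s ^ 2 + 4 * t)) / 2

/-- Generalized triangular numbers `{n+1 choose 2} = {n}·{n+1}/{2}`. -/
noncomputable def gtri (s t : ℝ) (n : ℕ) : ℝ :=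
  gfib s t n * gfib s t (n + 1) / gfib s t 2

/-- Generalized tetrahedral numbers
`{n+2 choose 3} = {n}·{n+1}·{n+2}/({1}·{2}·{3})`. -/
noncomputable def gtet (s t : ℝ) (n : ℕ) : ℝ :=
  gfib s t n * gfib s t (n + 1) * gfib s t (n + 2) /
    (gfib s t 1 * gfib s t 2 * gfib s t 3)

theorem gfib_binet (s t a b : ℝ) (h1 : a + b = s) (h2 : a * b = -t) (n : ℕ) :
    gfib s t n * (a - b) = a ^ n - b ^ n ∧
    gfib s t (n + 1) * (a - b) = a ^ (n + 1) - b ^ (n + 1) := by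
  induction n with
  | zero => simp [gfib]
  | succ k ih =>
    refine ⟨ih.2, ?_⟩
    have e : gfib s t (k + 1 + 1) = s * gfib s t (k + 1) + t * gfib s t k := by
      rw [gfib]
    have ht : t = -(a * b) := by linarith
    rw [e, add_mul, mul_assoc, mul_assoc, ih.1, ih.2, ht, ← h1]
    ring

theorem lambert_summable (x : ℝ) (hx : |x| < 1) :
    Summable (fun n : ℕ => x ^ (n + 1) / (1 - x ^ (n + 1))) := by
  have hg : Summable (fun n : ℕ => |x| ^ n * (1 / (1 - |x|))) :=
    (summable_geometric_of_lt_one (abs_nonneg x) hx).mul_right _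
  refine Summable.of_norm_bounded hg ?_
  intro n
  have h0 : |x| ^ (n + 1) ≤ |x| := pow_le_of_le_one (abs_nonneg x) hx.le (by omega)
  have h1 : |x| ^ (n + 1) ≤ |x| ^ n := pow_le_pow_of_le_one (abs_nonneg x) hx.le (by omega)
  have h2 : x ^ (n + 1) ≤ |x| ^ (n + 1) := by
    rw [← abs_pow]; exact le_abs_self _
  have h3 : 0 < 1 - |x| := by linarith
  have h4 : 0 < 1 - x ^ (n + 1) := by linarith
  rw [Real.norm_eq_abs, abs_div, abs_pow, abs_of_pos h4, div_eq_mul_one_div]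
  exact mul_le_mul h1 (one_div_le_one_div_of_le h3 (by linarith)) (by positivity) (by positivity)

theorem stmt18 (s t : ℝ) (hs : s ≠ 0) (ht : t ≠ 0) (hdisc : s ^ 2 + 4 * t > 0)
    (hlt : |phiST' s t| < |phiST s t|) :
    HasSum (fun n : ℕ => t ^ (n + 1) / gfib s t (2 * (n + 1)))
      (Real.sqrt (s ^ 2 + 4 * t) *
        ((∑' n : ℕ,
            (phiST' s t ^ 2 / t) ^ (n + 1) / (1 - (phiST' s t ^ 2 / t) ^ (n + 1))) -
          ∑' n : ℕ,
            (phiST' s t ^ 4 / t ^ 2) ^ (n + 1) /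
              (1 - (phiST' s t ^ 4 / t ^ 2) ^ (n + 1)))) := by
  have hD : 0 < Real.sqrt (s ^ 2 + 4 * t) := Real.sqrt_pos.mpr hdisc
  have hsq : Real.sqrt (s ^ 2 + 4 * t) ^ 2 = s ^ 2 + 4 * t := Real.sq_sqrt hdisc.le
  have hadd : phiST s t + phiST' s t = s := by unfold phiST phiST'; ring
  have hsub : phiST s t - phiST' s t = Real.sqrt (s ^ 2 + 4 * t) := by
    unfold phiST phiST'; ring
  have hmul : phiST s t * phiST' s t = -t := by
    unfold phiST phiST'; linear_combination (-1 / 4) * hsq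
  rw [← hsub] at hD ⊢
  generalize phiST s t = a at *
  generalize phiST' s t = b at *
  have ha : a ≠ 0 := by
    rintro rfl
    exact ht (by linarith)
  have hb : b ≠ 0 := by
    rintro rfl
    exact ht (by linarith)
  have htt : t = -(a * b) := by linarith
  have hxe : b ^ 2 / t = -(b / a) := by rw [htt]; field_simp
  have hx : |b ^ 2 / t| < 1 := by
    rw [hxe, abs_neg, abs_div]
    exact (div_lt_one (abs_pos.mpr ha)).mpr hlt
  have hx2e : b ^ 4 / t ^ 2 = (b ^ 2 / t) ^ 2 := by rw [div_pow]; ring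
  have hx2 : |b ^ 4 / t ^ 2| < 1 := by
    rw [hx2e, abs_pow]
    exact pow_lt_one₀ (abs_nonneg _) hx (by norm_num)
  have H := (((lambert_summable _ hx).hasSum).sub ((lambert_summable _ hx2).hasSum)).mul_left (a - b)
  refine (congrArg (fun f => HasSum f _) (funext fun n => ?_)).mpr H
  have hB := (gfib_binet s t a b hadd hmul (2 * (n + 1))).1
  have hlt1 : |(b ^ 2 / t) ^ (n + 1)| < 1 := by
    rw [abs_pow]
    exact pow_lt_one₀ (abs_nonneg _) hx (by omega)
  have e1 : t ^ (n + 1) = (b ^ 2 / t) ^ (n + 1) * a ^ (2 * (n + 1)) := by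
    rw [pow_mul, ← mul_pow, hxe, htt]
    congr 1
    field_simp
  have e2 : b ^ (2 * (n + 1)) = ((b ^ 2 / t) ^ (n + 1)) ^ 2 * a ^ (2 * (n + 1)) := by
    rw [← pow_mul, mul_comm (n + 1) 2, ← mul_pow, hxe, neg_mul, div_mul_cancel₀ _ ha,
      pow_mul, pow_mul, neg_sq]
  have e3 : (b ^ 4 / t ^ 2) ^ (n + 1) = ((b ^ 2 / t) ^ (n + 1)) ^ 2 := by
    rw [hx2e, ← pow_mul, ← pow_mul, mul_comm]
  rw [e2] at hB
  rw [e1, e3]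
  have hA : a ^ (2 * (n + 1)) ≠ 0 := pow_ne_zero _ ha
  generalize (b ^ 2 / t) ^ (n + 1) = y at *
  generalize a ^ (2 * (n + 1)) = A at *
  have hy := abs_lt.mp hlt1
  have hy1 : 1 - y ≠ 0 := (by linarith : 0 < 1 - y).ne'
  have hy2 : 1 + y ≠ 0 := (by linarith : 0 < 1 + y).ne'
  have hG : gfib s t (2 * (n + 1)) = A * ((1 - y) * (1 + y)) / (a - b) := by
    rw [eq_div_iff hD.ne', hB]; ring
  have hy3 : 1 - y ^ 2 = (1 - y) * (1 + y) := by ring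
  rw [hG, hy3]
  have hD' := hD.ne'
  field_simp
  ring
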